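/- arXiv:math/0209333 — 2 statements merged into one kernel-verified Lean document; each statement's English description precedes it below -/
import Mathlib

section
/- Let L be an even lattice and let K be an even overlattice of L corresponding to the isotropic subgroup C = K/L of the discriminant form (L*/L, q_L). Let C^⊥ = {x ∈ L*/L : b_L(x,c) = 0 for all c ∈ C}, where b_L is the bilinear form associated to q_L. Then q_L restricted to C^⊥ descends to a well-defined quadratic form q̄ on the quotient group C^⊥/C, and the discriminant form (K*/K, q_K) of K is isometric to (C^⊥/C, q̄). -/
open scoped BigOperators

noncomputable section

/-- The group `ℚ/ℤ`. -/
abbrev QmodZ : Type := ℚ ⧸ AddSubgroup.zmultiples (1 : ℚ)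

/-- The group `ℚ/2ℤ`. -/
abbrev Qmod2Z : Type := ℚ ⧸ AddSubgroup.zmultiples (2 : ℚ)

/-- The isomorphism `ℚ/2ℤ → ℚ/ℤ` induced by dividing by `2`. -/
noncomputable def halfHom : Qmod2Z →+ QmodZ :=
  QuotientAddGroup.map _ _ (AddMonoidHom.mk' (fun x : ℚ => x / 2) (fun a b => add_div a b 2))
    (by
      intro x hx
      obtain ⟨k, rfl⟩ := AddSubgroup.mem_zmultiples_iff.mp hx
      refine AddSubgroup.mem_zmultiples_iff.mpr ⟨k, ?_⟩
      show k • (1:ℚ) = (k • (2:ℚ)) / 2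
      push_cast [zsmul_eq_mul]
      ring)

/-- The bilinear form `b(x,y) = (q(x+y) - q(x) - q(y))/2 ∈ ℚ/ℤ` associated to
`q : A → ℚ/2ℤ`. -/
def bForm {A : Type*} [AddCommGroup A] (q : A → Qmod2Z) (x y : A) : QmodZ :=
  halfHom (q (x + y) - q x - q y)

/-- `q : A → ℚ/2ℤ` is a finite quadratic space structure on the finite abelian group `A`
if the associated form `b` is `ℤ`-bilinear (i.e. biadditive) and nondegenerate. -/
structure IsFiniteQuadraticSpace {A : Type*} [AddCommGroup A] [Finite A]
    (q : A → Qmod2Z) : Prop where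
  add_left : ∀ x x' y, bForm q (x + x') y = bForm q x y + bForm q x' y
  add_right : ∀ x y y', bForm q x (y + y') = bForm q x y + bForm q x y'
  nondeg : ∀ x, (∀ y, bForm q x y = 0) → x = 0

/-- Two quadratic forms are isometric if some group isomorphism carries one to the other. -/
def FQSIsometric {A B : Type*} [AddCommGroup A] [AddCommGroup B]
    (qA : A → Qmod2Z) (qB : B → Qmod2Z) : Prop :=
  ∃ e : A ≃+ B, ∀ x, qB (e x) = qA x

/-- An even lattice, given by its rank and Gram matrix: the Gram matrix is symmetric,
has even diagonal (so `(x,x)` is always even) and is nondegenerate. -/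
structure EvenLattice : Type where
  n : ℕ
  B : Matrix (Fin n) (Fin n) ℤ
  symm : B.IsSymm
  even_diag : ∀ i, 2 ∣ B i i
  nondeg : B.det ≠ 0

/-- The bilinear form of `L` extended to `R^n` for any commutative ring `R ⊇ ℤ`. -/
def formR (L : EvenLattice) (R : Type*) [CommRing R] (x y : Fin L.n → R) : R :=
  ∑ i, ∑ j, (L.B i j : R) * x i * y j

theorem formR_zero_left (L : EvenLattice) (R : Type*) [CommRing R] (y : Fin L.n → R) :
    formR L R 0 y = 0 := by
  simp [formR]

theorem formR_add_left (L : EvenLattice) (R : Type*) [CommRing R] (x x' y : Fin L.n → R) :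
    formR L R (x + x') y = formR L R x y + formR L R x' y := by
  simp [formR, mul_add, add_mul, Finset.sum_add_distrib]

theorem formR_neg_left (L : EvenLattice) (R : Type*) [CommRing R] (x y : Fin L.n → R) :
    formR L R (-x) y = -formR L R x y := by
  simp [formR, Finset.sum_neg_distrib]

/-- `L` and `M` are isometric over `R`. -/
def IsometricOver (R : Type*) [CommRing R] (L M : EvenLattice) : Prop :=
  ∃ e : (Fin L.n → R) ≃ₗ[R] (Fin M.n → R), ∀ x y, formR M R (e x) (e y) = formR L R x y

/-- `L` and `M` lie in the same genus: they are isometric over `ℤ_p` for all primes `p`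
and over `ℝ`. -/
def SameGenus (L M : EvenLattice) : Prop :=
  (∀ (p : ℕ) [Fact p.Prime], IsometricOver ℤ_[p] L M) ∧ IsometricOver ℝ L M

/-- The subgroup of integral vectors in `ℚ^n`, i.e. the lattice `L` itself inside `L ⊗ ℚ`. -/
def intSub (L : EvenLattice) : AddSubgroup (Fin L.n → ℚ) where
  carrier := {x | ∀ i, ∃ m : ℤ, x i = m}
  zero_mem' := fun i => ⟨0, by simp⟩
  add_mem' := by
    intro x y hx hy i
    obtain ⟨mx, hmx⟩ := hx i
    obtain ⟨my, hmy⟩ := hy i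
    exact ⟨mx + my, by simp [hmx, hmy]⟩
  neg_mem' := by
    intro x hx i
    obtain ⟨m, hm⟩ := hx i
    exact ⟨-m, by simp [hm]⟩

/-- The dual lattice of a subgroup `K` of `L ⊗ ℚ`:
all vectors pairing integrally with every element of `K`. -/
def dualOf (L : EvenLattice) (K : AddSubgroup (Fin L.n → ℚ)) : AddSubgroup (Fin L.n → ℚ) where
  carrier := {x | ∀ y ∈ K, ∃ m : ℤ, formR L ℚ x y = m}
  zero_mem' := fun y _ => ⟨0, by simp [formR_zero_left]⟩
  add_mem' := by
    intro x x' hx hx' y hy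
    obtain ⟨m, hm⟩ := hx y hy
    obtain ⟨m', hm'⟩ := hx' y hy
    exact ⟨m + m', by rw [formR_add_left, hm, hm']; push_cast; ring⟩
  neg_mem' := by
    intro x hx y hy
    obtain ⟨m, hm⟩ := hx y hy
    exact ⟨-m, by rw [formR_neg_left, hm]; push_cast; ring⟩

/-- The dual lattice `L^*` of `L`. -/
abbrev dualSub (L : EvenLattice) : AddSubgroup (Fin L.n → ℚ) := dualOf L (intSub L)

/-- The discriminant group `K^*/K` of a subgroup `K` of `L ⊗ ℚ`. -/
abbrev discGroupOf (L : EvenLattice) (K : AddSubgroup (Fin L.n → ℚ)) : Type :=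
  dualOf L K ⧸ K.addSubgroupOf (dualOf L K)

/-- The discriminant group `L^*/L`. -/
abbrev discGroup (L : EvenLattice) : Type := discGroupOf L (intSub L)

/-- The discriminant form on `K^*/K`, `q(x + K) = (x,x) mod 2ℤ`
(defined via a choice of representative; it is independent of this choice). -/
noncomputable def discQOf (L : EvenLattice) (K : AddSubgroup (Fin L.n → ℚ)) :
    discGroupOf L K → Qmod2Z :=
  fun a => (QuotientAddGroup.mk (formR L ℚ (a.out : Fin L.n → ℚ) (a.out : Fin L.n → ℚ)) : Qmod2Z)

/-- The discriminant form `q_L` on `L^*/L`. -/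
noncomputable def discQ (L : EvenLattice) : discGroup L → Qmod2Z := discQOf L (intSub L)

/-- `n₊`: the maximal dimension of a positive definite subspace of `L ⊗ ℝ`. -/
noncomputable def sigPlus (L : EvenLattice) : ℕ :=
  sSup {d : ℕ | ∃ W : Submodule ℝ (Fin L.n → ℝ), Module.finrank ℝ W = d ∧
    ∀ x ∈ W, x ≠ 0 → 0 < formR L ℝ x x}

/-- `n₋`: the maximal dimension of a negative definite subspace of `L ⊗ ℝ`. -/
noncomputable def sigMinus (L : EvenLattice) : ℕ :=
  sSup {d : ℕ | ∃ W : Submodule ℝ (Fin L.n → ℝ), Module.finrank ℝ W = d ∧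
    ∀ x ∈ W, x ≠ 0 → formR L ℝ x x < 0}

end

/-- `K` is an even overlattice of `L`: a subgroup of `L ⊗ ℚ` containing `L` on which the
extended bilinear form is integral and the associated quadratic form is even. -/
def IsEvenOverlattice (L : EvenLattice) (K : AddSubgroup (Fin L.n → ℚ)) : Prop :=
  intSub L ≤ K ∧ (∀ x ∈ K, ∀ y ∈ K, ∃ m : ℤ, formR L ℚ x y = m) ∧
    (∀ x ∈ K, ∃ m : ℤ, formR L ℚ x x = 2 * m)

/-- The subgroup `K/L` of the discriminant group `L^*/L` attached to an overlattice `K`. -/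
def overToSub (L : EvenLattice) (K : AddSubgroup (Fin L.n → ℚ)) : AddSubgroup (discGroup L) :=
  AddSubgroup.map (QuotientAddGroup.mk' ((intSub L).addSubgroupOf (dualSub L)))
    (K.addSubgroupOf (dualSub L))


theorem aux_formR_symm (L : EvenLattice) (x y : Fin L.n → ℚ) :
    formR L ℚ x y = formR L ℚ y x := by
  unfold formR
  rw [Finset.sum_comm]
  refine Finset.sum_congr rfl fun i _ => Finset.sum_congr rfl fun j _ => ?_
  rw [L.symm.apply i j]
  ring

theorem aux_formR_add_right (L : EvenLattice) (x y y' : Fin L.n → ℚ) :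
    formR L ℚ x (y + y') = formR L ℚ x y + formR L ℚ x y' := by
  rw [aux_formR_symm, formR_add_left, aux_formR_symm L y, aux_formR_symm L y']

theorem aux_even (L : EvenLattice) (m : Fin L.n → ℤ) :
    (2 : ℤ) ∣ ∑ i, ∑ j, L.B i j * m i * m j := by
  have h2 : (((∑ i, ∑ j, L.B i j * m i * m j : ℤ)) : ZMod 2) = 0 := by
    rw [← Finset.sum_product']
    rw [Int.cast_sum]
    refine Finset.sum_involution (fun a _ => (a.2, a.1)) ?_ ?_ ?_ ?_
    · rintro ⟨i, j⟩ _
      have : L.B j i * m j * m i = L.B i j * m i * m j := by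
        rw [L.symm.apply i j]; ring
      simp only [this]
      exact CharTwo.add_self_eq_zero _
    · rintro ⟨i, j⟩ _ h heq
      apply h
      have hij : j = i := congrArg Prod.fst heq
      subst hij
      have := (ZMod.intCast_zmod_eq_zero_iff_dvd (L.B j j) 2).2 (by exact_mod_cast L.even_diag j)
      push_cast
      rw [this]; ring
    · intros; simp
    · intros; rfl
  exact_mod_cast (ZMod.intCast_zmod_eq_zero_iff_dvd _ 2).1 h2

theorem aux_int_over (L : EvenLattice) : IsEvenOverlattice L (intSub L) := by
  refine ⟨le_rfl, ?_, ?_⟩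
  · intro x hx y hy
    choose a ha using hx
    choose b hb using hy
    refine ⟨∑ i, ∑ j, L.B i j * a i * b j, ?_⟩
    simp [formR, ha, hb]
  · intro x hx
    choose a ha using hx
    obtain ⟨k, hk⟩ := aux_even L a
    refine ⟨k, ?_⟩
    have : formR L ℚ x x = ((∑ i, ∑ j, L.B i j * a i * a j : ℤ) : ℚ) := by
      simp [formR, ha]
    rw [this, hk]; push_cast; ring

theorem aux_le_dual (L : EvenLattice) (K : AddSubgroup (Fin L.n → ℚ))
    (hK : IsEvenOverlattice L K) : K ≤ dualOf L K := fun x hx y hy => hK.2.1 x hx y hy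

theorem aux_dual_anti (L : EvenLattice) (K : AddSubgroup (Fin L.n → ℚ))
    (hK : IsEvenOverlattice L K) : dualOf L K ≤ dualSub L :=
  fun _ hx y hy => hx y (hK.1 hy)

theorem aux_discQOf_mk (L : EvenLattice) (K : AddSubgroup (Fin L.n → ℚ))
    (hK : IsEvenOverlattice L K) (x : dualOf L K) :
    discQOf L K (QuotientAddGroup.mk x) =
      (QuotientAddGroup.mk (formR L ℚ (x : Fin L.n → ℚ) x) : Qmod2Z) := by
  unfold discQOf
  set y : dualOf L K := Quotient.out (QuotientAddGroup.mk x : discGroupOf L K) with hy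
  have h1 : (QuotientAddGroup.mk y : discGroupOf L K) = QuotientAddGroup.mk x :=
    Quotient.out_eq _
  have h2 : ((-y + x : dualOf L K) : Fin L.n → ℚ) ∈ K := by
    have h3 : -y + x ∈ K.addSubgroupOf (dualOf L K) := QuotientAddGroup.eq.1 h1
    exact h3
  set k : Fin L.n → ℚ := ((-y + x : dualOf L K) : Fin L.n → ℚ) with hk
  have hx : (x : Fin L.n → ℚ) = y + k := by simp [hk]
  obtain ⟨a, ha⟩ := y.2 k h2
  obtain ⟨b, hb⟩ := hK.2.2 k h2
  rw [QuotientAddGroup.eq]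
  refine AddSubgroup.mem_zmultiples_iff.2 ⟨a + b, ?_⟩
  rw [hx, formR_add_left, aux_formR_add_right, aux_formR_add_right, aux_formR_symm L k y, ha, hb]
  simp only [zsmul_eq_mul]
  push_cast
  ring

theorem aux_bForm_mk (L : EvenLattice) (x y : dualSub L) :
    bForm (discQ L) (QuotientAddGroup.mk x) (QuotientAddGroup.mk y) =
      (QuotientAddGroup.mk (formR L ℚ (x : Fin L.n → ℚ) y) : QmodZ) := by
  unfold bForm discQ
  rw [← QuotientAddGroup.mk_add]
  rw [aux_discQOf_mk L _ (aux_int_over L), aux_discQOf_mk L _ (aux_int_over L),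
    aux_discQOf_mk L _ (aux_int_over L)]
  rw [← QuotientAddGroup.mk_sub, ← QuotientAddGroup.mk_sub]
  change (QuotientAddGroup.mk ((formR L ℚ ((x + y : dualSub L) : Fin L.n → ℚ) (x + y : dualSub L)
    - formR L ℚ (x : Fin L.n → ℚ) x - formR L ℚ (y : Fin L.n → ℚ) y) / 2) : QmodZ) = _
  congr 1
  rw [AddSubgroup.coe_add, formR_add_left, aux_formR_add_right, aux_formR_add_right,
    aux_formR_symm L y x]
  ring

theorem aux_QmodZ (r : ℚ) : (QuotientAddGroup.mk r : QmodZ) = 0 ↔ ∃ m : ℤ, r = m := by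
  rw [QuotientAddGroup.eq_zero_iff, AddSubgroup.mem_zmultiples_iff]
  simp [eq_comm]

theorem aux_mem_over (L : EvenLattice) (K : AddSubgroup (Fin L.n → ℚ))
    (hK : intSub L ≤ K) (x : dualSub L) :
    (QuotientAddGroup.mk x : discGroup L) ∈ overToSub L K ↔ (x : Fin L.n → ℚ) ∈ K := by
  constructor
  · rintro ⟨y, hy, hyx⟩
    have h2 : ((-y + x : dualSub L) : Fin L.n → ℚ) ∈ intSub L := by
      have h4 : -y + x ∈ (intSub L).addSubgroupOf (dualSub L) := QuotientAddGroup.eq.1 hyx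
      exact h4
    have h3 := K.add_mem (show (y : Fin L.n → ℚ) ∈ K from hy) (hK h2)
    simpa using h3
  · intro h
    exact ⟨x, h, rfl⟩

/-- **Discriminant form of an overlattice.** Let `K` be an even overlattice of `L` with
corresponding isotropic subgroup `C = K/L ⊆ L^*/L`. Then the orthogonal complement
`C^⊥ = {x : b_L(x,c) = 0 ∀ c ∈ C}` is a subgroup, `q_L` restricted to `C^⊥` descends to a
well-defined form `q̄` on `C^⊥/C`, and the discriminant form `(K^*/K, q_K)` is isometric
to `(C^⊥/C, q̄)`. -/
theorem discriminant_form_of_overlattice (L : EvenLattice)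
    (K : AddSubgroup (Fin L.n → ℚ)) (hK : IsEvenOverlattice L K) :
    ∃ Cperp : AddSubgroup (discGroup L),
      (∀ x, x ∈ Cperp ↔ ∀ c ∈ overToSub L K, bForm (discQ L) x c = 0) ∧
      ∃ qbar : (Cperp ⧸ (overToSub L K).addSubgroupOf Cperp) → Qmod2Z,
        (∀ x : Cperp, qbar (QuotientAddGroup.mk x) = discQ L (x : discGroup L)) ∧
        FQSIsometric (discQOf L K) qbar := by
  classical
  have hL := aux_le_dual L K hK
  have hD := aux_dual_anti L K hK
  have hLD : intSub L ≤ dualOf L K := hK.1.trans hL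
  refine ⟨overToSub L (dualOf L K), ?_, ?_⟩
  · intro x
    obtain ⟨x, rfl⟩ := QuotientAddGroup.mk_surjective x
    rw [aux_mem_over L _ hLD]
    constructor
    · intro hx c hc
      obtain ⟨c, rfl⟩ := QuotientAddGroup.mk_surjective c
      rw [aux_mem_over L _ hK.1] at hc
      rw [aux_bForm_mk, aux_QmodZ]
      exact hx c hc
    · intro h y hy
      have h1 := h (QuotientAddGroup.mk ⟨y, hD (hL hy)⟩) ((aux_mem_over L _ hK.1 _).2 hy)
      rw [aux_bForm_mk, aux_QmodZ] at h1
      exact h1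
  · set P := overToSub L (dualOf L K) with hP
    let ψ : dualOf L K →+ P :=
      ((QuotientAddGroup.mk' ((intSub L).addSubgroupOf (dualSub L))).comp
        (AddSubgroup.inclusion hD)).codRestrict P
        (fun z => (aux_mem_over L _ hLD (AddSubgroup.inclusion hD z)).2 z.2)
    let φ : dualOf L K →+ (P ⧸ (overToSub L K).addSubgroupOf P) :=
      (QuotientAddGroup.mk' _).comp ψ
    have hψ : Function.Surjective ψ := by
      rintro ⟨x, hx⟩
      obtain ⟨x, rfl⟩ := QuotientAddGroup.mk_surjective x
      exact ⟨⟨x, (aux_mem_over L _ hLD x).1 hx⟩, rfl⟩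
    have hφ : Function.Surjective φ := (QuotientAddGroup.mk'_surjective _).comp hψ
    have hker : K.addSubgroupOf (dualOf L K) = φ.ker := by
      ext z
      rw [AddMonoidHom.mem_ker]
      change _ ↔ (QuotientAddGroup.mk (ψ z) : P ⧸ (overToSub L K).addSubgroupOf P) = 0
      rw [QuotientAddGroup.eq_zero_iff]
      exact (aux_mem_over L K hK.1 (AddSubgroup.inclusion hD z)).symm
    let e : discGroupOf L K ≃+ (P ⧸ (overToSub L K).addSubgroupOf P) :=
      (QuotientAddGroup.quotientAddEquivOfEq hker).trans
        (QuotientAddGroup.quotientKerEquivOfSurjective φ hφ)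
    have he : ∀ z : dualOf L K, e (QuotientAddGroup.mk z) = QuotientAddGroup.mk (ψ z) :=
      fun z => rfl
    refine ⟨fun a => discQOf L K (e.symm a), ?_, e, fun x => by simp⟩
    intro x
    obtain ⟨z, rfl⟩ := hψ x
    simp only []
    rw [← he, AddEquiv.symm_apply_apply, aux_discQOf_mk L K hK]
    exact (aux_discQOf_mk L _ (aux_int_over L) (AddSubgroup.inclusion hD z)).symm
end

section
/- Let L be an even unimodular lattice (i.e., L = L*) with signature (n₊, n₋). Then n₊ − n₋ ≡ 0 (mod 8). In particular, a positive definite even unimodular lattice has rank divisible by 8. -/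
open scoped BigOperators

open Complex Filter Topology HurwitzZeta Real in
theorem theta_side1 (d N : ℕ) (hd : 0 < d) (hde : Even d) (hN : d ∣ N) (hN0 : 0 < N) :
    Tendsto (fun t : ℝ => ((√t : ℝ) : ℂ) * jacobiTheta₂ 0 (1 / d + I * t)) (𝓝[>] 0)
      (𝓝 (∑ k : Fin N, cexp (π * I * (k.val : ℂ) ^ 2 / d) * (1 / N))) := by
  have : NeZero N := ⟨hN0.ne'⟩
  have hNr : (0:ℝ) < N := by exact_mod_cast hN0
  have hNc : (N:ℂ) ≠ 0 := by exact_mod_cast hN0.ne'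
  have hdc : (d:ℂ) ≠ 0 := by exact_mod_cast hd.ne'
  have key : ∀ t : ℝ, 0 < t → jacobiTheta₂ 0 (1 / d + I * t) =
      ∑ k : Fin N, cexp (π * I * (k.val : ℂ) ^ 2 / d) *
        ((evenKernel ((((k.val:ℝ) / N : ℝ)) : UnitAddCircle) (N ^ 2 * t) : ℝ) : ℂ) := by
    intro t ht
    have him : 0 < ((1 / d + I * t : ℂ)).im := by
      have : (1 / d + I * t : ℂ) = ((1 / d : ℝ) : ℂ) + t * I := by push_cast; ring
      rw [this]; simpa using ht
    have h1 := hasSum_jacobiTheta₂_term 0 him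
    have h2 := ((Int.divModEquiv N).symm.hasSum_iff).mpr h1
    have h3 := ((Equiv.prodComm (Fin N) ℤ).hasSum_iff).mpr h2
    have h4 := h3.prod_fiberwise (g := fun k : Fin N => cexp (π * I * (k.val : ℂ) ^ 2 / d) *
        ((evenKernel ((((k.val:ℝ) / N : ℝ)) : UnitAddCircle) (N ^ 2 * t) : ℝ) : ℂ)) ?_
    · exact h4.unique (hasSum_fintype _)
    · intro k
      have h5 := hasSum_int_evenKernel ((k.val:ℝ)/N) (t := N^2 * t) (by positivity)
      have h6 := (hasSum_ofReal.mpr h5).mul_left (cexp (π * I * (k.val : ℂ) ^ 2 / d))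
      refine (congrArg (fun F => HasSum F _) (funext fun m => ?_)).mpr h6
      simp only [Function.comp, Equiv.prodComm_apply, Prod.swap, Int.divModEquiv_symm_apply,
        jacobiTheta₂_term]
      push_cast
      rw [← Complex.exp_add, Complex.exp_eq_exp_iff_exists_int]
      obtain ⟨e, he⟩ := hN
      obtain ⟨f, hf⟩ := hde
      have hdf : (d:ℂ) = 2 * f := by rw [hf]; push_cast; ring
      refine ⟨m ^ 2 * e ^ 2 * f + m * e * k.val, ?_⟩
      have hNe : (N:ℂ) = d * e := by exact_mod_cast he
      have hec : (e:ℂ) ≠ 0 := by rintro h; apply hNc; rw [hNe, h, mul_zero]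
      have hfc : (f:ℂ) ≠ 0 := by rintro h; apply hdc; rw [hdf, h, mul_zero]
      rw [hNe, hdf]
      push_cast
      field_simp
      ring_nf
      simp only [I_sq]
      ring
  have lim : ∀ k : Fin N, Tendsto (fun t : ℝ => √t *
      evenKernel ((((k.val:ℝ) / N : ℝ)) : UnitAddCircle) (N ^ 2 * t)) (𝓝[>] 0) (𝓝 (1 / N)) := by
    intro k
    set a : UnitAddCircle := ((((k.val:ℝ) / N : ℝ)) : UnitAddCircle)
    obtain ⟨p, hp, hO⟩ := isBigO_atTop_cosKernel_sub a
    have h1 : Tendsto (fun x => cosKernel a x - 1) atTop (𝓝 0) := by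
      apply hO.trans_tendsto
      exact Real.tendsto_exp_atBot.comp (tendsto_id.const_mul_atTop_of_neg (by linarith : -p < 0))
    have h2 : Tendsto (fun x => cosKernel a x) atTop (𝓝 1) := by
      simpa using h1.add_const 1
    have h3 : Tendsto (fun t : ℝ => 1 / ((N:ℝ)^2 * t)) (𝓝[>] 0) atTop := by
      have := (tendsto_inv_nhdsGT_zero (𝕜 := ℝ)).const_mul_atTop (r := 1 / (N:ℝ)^2) (by positivity)
      refine this.congr fun t => ?_
      field_simp
    have h4 := (h2.comp h3).const_mul (1 / (N:ℝ))
    rw [mul_one] at h4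
    refine h4.congr' ?_
    filter_upwards [self_mem_nhdsWithin] with t ht
    have ht : 0 < t := ht
    rw [evenKernel_functional_equation]
    have : ((N:ℝ)^2 * t) ^ (1/2:ℝ) = N * √t := by
      rw [← Real.sqrt_eq_rpow, Real.sqrt_mul (by positivity), Real.sqrt_sq hNr.le]
    rw [this]
    have : √t ≠ 0 := (Real.sqrt_pos.mpr ht).ne'
    simp only [Function.comp]
    field_simp
  have : Tendsto (fun t : ℝ => ∑ k : Fin N, cexp (π * I * (k.val : ℂ) ^ 2 / d) *
      ((√t * evenKernel ((((k.val:ℝ) / N : ℝ)) : UnitAddCircle) (N ^ 2 * t) : ℝ) : ℂ)) (𝓝[>] 0)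
      (𝓝 (∑ k : Fin N, cexp (π * I * (k.val : ℂ) ^ 2 / d) * ((1 / N : ℝ) : ℂ))) := by
    apply tendsto_finsetSum
    intro k _
    exact ((continuous_ofReal.tendsto _).comp (lim k)).const_mul _
  push_cast at this
  refine this.congr' ?_
  filter_upwards [self_mem_nhdsWithin] with t ht
  rw [key t ht, Finset.mul_sum]
  refine Finset.sum_congr rfl fun k _ => ?_
  ring

open Complex Filter Topology HurwitzZeta Real in
theorem theta_side2 (d : ℕ) (hd : 0 < d) (hde : Even d) :
    Tendsto (fun t : ℝ => ((√t : ℝ) : ℂ) * jacobiTheta₂ 0 (1 / d + I * t)) (𝓝[>] 0)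
      (𝓝 (((1 / √d : ℝ) : ℂ) * cexp (π * I / 4))) := by
  have hdr : (0:ℝ) < d := by exact_mod_cast hd
  have hdc : (d:ℂ) ≠ 0 := by exact_mod_cast hd.ne'
  have key : ∀ t : ℝ, 0 < t → ((√t : ℝ) : ℂ) * jacobiTheta₂ 0 (1 / d + I * t) =
     1 / (-I * (1 / d + I * t)) ^ (1 / 2 : ℂ) * (1 / (d / (1 / d + I * t)) ^ (1/2:ℂ)) *
      jacobiTheta (I * (((1 / d) ^ 2 / t : ℝ)) + ((-(1 / d) : ℝ) : ℂ)) := by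
    intro t ht
    have htc : (t:ℂ) ≠ 0 := by exact_mod_cast ht.ne'
    have hτ : (1 / d + I * t : ℂ) ≠ 0 := by
      intro h
      have := congrArg im h
      have h' : (1 / d + I * t : ℂ) = ((1 / d : ℝ) : ℂ) + t * I := by push_cast; ring
      rw [h'] at this
      simp at this
      exact ht.ne' this
    have hτ2 : (1 + d * I * t : ℂ) ≠ 0 := by
      intro h; apply hτ; field_simp; linear_combination h
    set w : ℂ := t * (d / (1 / d + I * t)) with hw
    have hwne : w ≠ 0 := mul_ne_zero htc (div_ne_zero hdc hτ)
    have e1 : jacobiTheta₂ 0 (-1 / (1 / d + I * t)) = jacobiTheta₂ 0 (I * w) := by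
      unfold jacobiTheta₂
      refine tsum_congr fun n => ?_
      unfold jacobiTheta₂_term
      rw [Complex.exp_eq_exp_iff_exists_int]
      obtain ⟨f, hf⟩ := hde
      refine ⟨- n^2 * f, ?_⟩
      have hdf : (f:ℂ) = d / 2 := by rw [hf]; push_cast; ring
      push_cast
      have hq : (1 / d + I * t : ℂ) = (1 + d * I * t) / d := by field_simp
      rw [hdf, hw, hq]
      generalize hz : (1 + d * I * t : ℂ) = z at hτ2
      have hz' : (d * I * t : ℂ) = z - 1 := by rw [← hz]; ring
      field_simp
      linear_combination (-((n:ℂ)^2 * d)) * hz'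
    rw [jacobiTheta₂_functional_equation, zero_div, e1, jacobiTheta₂_functional_equation 0 (I * w),
      zero_div, jacobiTheta_eq_jacobiTheta₂]
    have e2 : -I * (I * w) = w := by linear_combination (-w) * I_sq
    have e3 : -1 / (I * w) = I * (((1 / d) ^ 2 / t : ℝ)) + ((-(1 / d) : ℝ) : ℂ) := by
      rw [hw]; push_cast
      field_simp
      ring_nf
      simp only [I_sq]
      ring
    rw [e2, e3]
    have e4 : w ^ (1/2:ℂ) = ((√t:ℝ):ℂ) * (d / (1 / d + I * t)) ^ (1/2:ℂ) := by
      have hc := div_ne_zero hdc hτ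
      have h2 : ((√t:ℝ):ℂ) = (t:ℂ) ^ (1/2:ℂ) := by
        rw [Real.sqrt_eq_rpow, Complex.ofReal_cpow ht.le]; norm_num
      rw [h2, hw, cpow_def_of_ne_zero (mul_ne_zero htc hc), cpow_def_of_ne_zero htc,
        cpow_def_of_ne_zero hc, Complex.log_ofReal_mul ht hc, ← Complex.exp_add,
        ← Complex.ofReal_log ht.le]
      ring_nf
    rw [e4]
    have : ((√t:ℝ):ℂ) ≠ 0 := by exact_mod_cast (Real.sqrt_pos.mpr ht).ne'
    simp
    field_simp
  have hcont : ContinuousAt (fun t : ℝ => 1 / (-I * (1 / d + I * t)) ^ (1 / 2 : ℂ) *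
      (1 / (d / (1 / d + I * t)) ^ (1/2:ℂ))) 0 := by
    have s1 : (-I * (1 / d + I * ((0:ℝ):ℂ)) : ℂ) ∈ slitPlane := by
      rw [mem_slitPlane_iff]; right
      have : (-I * (1 / d + I * ((0:ℝ):ℂ)) : ℂ) = ((-(1/d) : ℝ) : ℂ) * I := by push_cast; ring
      rw [this]; simp; exact hd.ne'
    have s2 : (d / (1 / d + I * ((0:ℝ):ℂ)) : ℂ) ∈ slitPlane := by
      have : (d / (1 / d + I * ((0:ℝ):ℂ)) : ℂ) = ((d ^ 2 : ℝ) : ℂ) := by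
        push_cast; field_simp; simp
      rw [this, ofReal_mem_slitPlane]; positivity
    have c0 : ContinuousAt (fun t : ℝ => (1 / d + I * t : ℂ)) 0 := by fun_prop
    have c1 : ContinuousAt (fun t : ℝ => (-I * (1 / d + I * t) : ℂ) ^ (1/2:ℂ)) 0 :=
      (continuousAt_const.mul c0).cpow continuousAt_const s1
    have c2 : ContinuousAt (fun t : ℝ => (d / (1 / d + I * t) : ℂ) ^ (1/2:ℂ)) 0 :=
      (continuousAt_const.div c0 (by simpa using hd.ne')).cpow continuousAt_const s2
    refine (continuousAt_const.div c1 ?_).mul (continuousAt_const.div c2 ?_)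
    · rw [Ne, cpow_eq_zero_iff]; rintro ⟨h, -⟩; exact slitPlane_ne_zero s1 h
    · rw [Ne, cpow_eq_zero_iff]; rintro ⟨h, -⟩; exact slitPlane_ne_zero s2 h
  have hval : 1 / (-I * (1 / d + I * ((0:ℝ):ℂ))) ^ (1 / 2 : ℂ) *
      (1 / (d / (1 / d + I * ((0:ℝ):ℂ))) ^ (1/2:ℂ)) = ((1 / √d : ℝ) : ℂ) * cexp (π * I / 4) := by
    have a1 : (d / (1 / d + I * ((0:ℝ):ℂ)) : ℂ) = ((d ^ 2 : ℝ) : ℂ) := by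
      push_cast; field_simp; simp
    have a2 : ((d ^ 2 : ℝ) : ℂ) ^ (1/2:ℂ) = d := by
      have : (1/2:ℂ) = ((1/2:ℝ):ℂ) := by norm_num
      rw [this, ← ofReal_cpow (by positivity), ← Real.sqrt_eq_rpow, Real.sqrt_sq hdr.le]
      simp
    have a3 : (-I * (1 / d + I * ((0:ℝ):ℂ)) : ℂ) = ((1/d : ℝ) : ℂ) * (-I) := by push_cast; ring
    have a4 : (((1/d : ℝ) : ℂ) * (-I)) ^ (1/2:ℂ) = ((1 / √d : ℝ) : ℂ) * cexp (-(π * I / 4)) := by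
      have hp : (0:ℝ) < 1 / d := by positivity
      have h2 : ((1/√d : ℝ) : ℂ) = ((1/d:ℝ):ℂ) ^ (1/2:ℂ) := by
        have : (1/2:ℂ) = ((1/2:ℝ):ℂ) := by norm_num
        rw [this, ← ofReal_cpow hp.le, ← Real.sqrt_eq_rpow, Real.sqrt_div zero_le_one, Real.sqrt_one]
      have hpc : ((1/d:ℝ):ℂ) ≠ 0 := by exact_mod_cast hp.ne'
      rw [h2, cpow_def_of_ne_zero (mul_ne_zero hpc (neg_ne_zero.mpr I_ne_zero)),
        cpow_def_of_ne_zero hpc, Complex.log_ofReal_mul hp (neg_ne_zero.mpr I_ne_zero),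
        ← Complex.exp_add, ← Complex.ofReal_log hp.le, Complex.log_neg_I]
      ring_nf
    rw [a1, a2, a3, a4, Complex.exp_neg]
    have h5 : ((√d:ℝ):ℂ) ≠ 0 := by exact_mod_cast (Real.sqrt_pos.mpr hdr).ne'
    have h6 : ((√d:ℝ):ℂ) ^ 2 = d := by
      rw [← ofReal_pow, Real.sq_sqrt hdr.le]; simp
    have h7 := Complex.exp_ne_zero (π * I / 4)
    push_cast
    field_simp
    exact h6
  have hth : Tendsto (fun t : ℝ => jacobiTheta (I * (((1 / d) ^ 2 / t : ℝ)) + ((-(1 / d) : ℝ) : ℂ)))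
      (𝓝[>] 0) (𝓝 1) := by
    have h1 : Tendsto (fun t : ℝ => (I * (((1 / d) ^ 2 / t : ℝ)) + ((-(1 / d) : ℝ) : ℂ)))
        (𝓝[>] 0) (comap im atTop) := by
      rw [tendsto_comap_iff]
      have := (tendsto_inv_nhdsGT_zero (𝕜 := ℝ)).const_mul_atTop (r := (1 / (d:ℝ))^2) (by positivity)
      refine this.congr fun t => ?_
      simp only [Function.comp, add_im, ofReal_im, I_mul_im, ofReal_re]
      ring
    have h2 : Tendsto (fun τ => jacobiTheta τ - 1) (comap im atTop) (𝓝 0) := by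
      apply isBigO_at_im_infty_jacobiTheta_sub_one.trans_tendsto
      exact Real.tendsto_exp_atBot.comp ((tendsto_comap).const_mul_atTop_of_neg
        (by linarith [Real.pi_pos] : -π < 0))
    simpa using (h2.comp h1).add_const 1
  have h1 := hcont.tendsto
  rw [hval] at h1
  have h2 := (h1.mono_left nhdsWithin_le_nhds).mul hth
  rw [mul_one] at h2
  refine h2.congr' ?_
  filter_upwards [self_mem_nhdsWithin] with t ht
  exact (key t ht).symm

open Real in
theorem gauss_pos (d N : ℕ) (hd : 0 < d) (hde : Even d) (hN : d ∣ N) (hN0 : 0 < N) :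
    ∑ k : Fin N, Complex.exp (π * Complex.I * (k.val : ℂ) ^ 2 / d) =
      ((N / √d : ℝ) : ℂ) * Complex.exp (π * Complex.I / 4) := by
  have h := tendsto_nhds_unique (theta_side1 d N hd hde hN hN0) (theta_side2 d hd hde)
  rw [← Finset.sum_mul] at h
  have hNc : (N:ℂ) ≠ 0 := by exact_mod_cast hN0.ne'
  field_simp at h
  rw [h]
  push_cast
  ring

/-- The bilinear form attached to `L` over `R`. -/
noncomputable def blForm (L : EvenLattice) (R : Type*) [CommRing R] :
    LinearMap.BilinForm R (Fin L.n → R) :=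
  Matrix.toBilin' (L.B.map (Int.cast : ℤ → R))

theorem blForm_apply (L : EvenLattice) (R : Type*) [CommRing R] (x y : Fin L.n → R) :
    blForm L R x y = formR L R x y := by
  simp only [blForm, Matrix.toBilin'_apply, formR, Matrix.map_apply]
  refine Finset.sum_congr rfl fun i _ => Finset.sum_congr rfl fun j _ => by ring

theorem formR_comm (L : EvenLattice) (R : Type*) [CommRing R] (x y : Fin L.n → R) :
    formR L R x y = formR L R y x := by
  unfold formR
  rw [Finset.sum_comm]
  refine Finset.sum_congr rfl fun i _ => Finset.sum_congr rfl fun j _ => ?_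
  rw [L.symm.apply i j]; ring

theorem formR_cast (L : EvenLattice) (R : Type*) [CommRing R] (x y : Fin L.n → ℤ) :
    formR L R (fun i => (x i : R)) (fun i => (y i : R)) = ((formR L ℤ x y : ℤ) : R) := by
  simp [formR]

theorem formR_even (L : EvenLattice) (x : Fin L.n → ℤ) : Even (formR L ℤ x x) := by
  rw [even_iff_two_dvd]
  refine (ZMod.intCast_zmod_eq_zero_iff_dvd _ 2).mp ?_
  unfold formR
  push_cast
  rw [← Finset.sum_product']
  refine Finset.sum_involution (fun p _ => p.swap) ?_ ?_ ?_ ?_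
  · rintro ⟨i, j⟩ _
    simp only [Prod.swap]
    rw [L.symm.apply i j]
    have : ∀ a b c : ZMod 2, a * b * c + a * c * b = 0 := by decide
    exact this _ _ _
  · rintro ⟨i, j⟩ _ h heq
    simp only [Prod.swap, Prod.mk.injEq] at heq
    obtain ⟨rfl, -⟩ := heq
    apply h
    have := (ZMod.intCast_zmod_eq_zero_iff_dvd (L.B j j) 2).mpr (by exact_mod_cast L.even_diag j)
    simp [this]
  · intro p _; simp
  · intro p _; simp

theorem exists_orth (L : EvenLattice) : ∃ v : Fin L.n → Fin L.n → ℤ,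
    (∀ i j, i ≠ j → formR L ℤ (v i) (v j) = 0) ∧ ∀ i, formR L ℤ (v i) (v i) ≠ 0 := by
  have : Invertible (2:ℚ) := invertibleOfNonzero two_ne_zero
  have hs : LinearMap.IsSymm (blForm L ℚ) := ⟨fun x y => by
    simp only [RingHom.id_apply, blForm_apply]; exact formR_comm L ℚ x y⟩
  obtain ⟨b0, hb0⟩ := LinearMap.BilinForm.exists_orthogonal_basis hs
  have hfr : Module.finrank ℚ (Fin L.n → ℚ) = L.n := by simp
  have hnd : (blForm L ℚ).Nondegenerate := by
    apply LinearMap.BilinForm.nondegenerate_toBilin'_of_det_ne_zero'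
    have : (L.B.map (Int.cast : ℤ → ℚ)).det = ((L.B.det : ℤ) : ℚ) := by
      have := (Int.castRingHom ℚ).map_det L.B
      simpa using this.symm
    rw [this]
    exact_mod_cast L.nondeg
  have hne := hb0.not_isOrtho_basis_self_of_separatingLeft hnd.1
  let b : Fin L.n → (Fin L.n → ℚ) := fun i => b0 (finCongr hfr.symm i)
  have hbo : ∀ i j, i ≠ j → formR L ℚ (b i) (b j) = 0 := fun i j hij => by
    rw [← blForm_apply]
    exact hb0 (by simpa using hij)
  have hbn : ∀ i, formR L ℚ (b i) (b i) ≠ 0 := fun i => by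
    rw [← blForm_apply]; exact hne _
  have hc : ∀ i, ∃ (c : ℤ) (u : Fin L.n → ℤ), c ≠ 0 ∧ (fun j => (u j : ℚ)) = (c : ℚ) • b i := by
    intro i
    refine ⟨∏ j, ((b i j).den : ℤ), fun j => (∏ k ∈ Finset.univ.erase j, ((b i k).den : ℤ)) * (b i j).num,
      ?_, ?_⟩
    · exact Finset.prod_ne_zero_iff.mpr fun j _ => by exact_mod_cast (b i j).den_nz
    · funext j
      rw [Pi.smul_apply, smul_eq_mul, ← Finset.prod_erase_mul _ _ (Finset.mem_univ j)]
      push_cast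
      rw [mul_assoc, Rat.den_mul_eq_num]
  choose c v hc hv using hc
  have hf : ∀ i j, ((formR L ℤ (v i) (v j) : ℤ) : ℚ) = c i * (c j * formR L ℚ (b i) (b j)) := by
    intro i j
    rw [← formR_cast, hv, hv, ← blForm_apply, ← blForm_apply]
    simp
    ring
  refine ⟨v, fun i j hij => ?_, fun i => ?_⟩
  · have := hf i j
    rw [hbo i j hij] at this
    simpa using this
  · intro h
    have := hf i i
    rw [h] at this
    have h1 : (c i : ℚ) ≠ 0 := by exact_mod_cast hc i
    have := hbn i
    simp_all

/-- The basis of `R^n` given by an orthogonal family. -/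
theorem exists_basis (L : EvenLattice) (R : Type*) [Field R] [CharZero R]
    (v : Fin L.n → Fin L.n → ℤ)
    (ho : ∀ i j, i ≠ j → formR L ℤ (v i) (v j) = 0) (hn : ∀ i, formR L ℤ (v i) (v i) ≠ 0) :
    ∃ b : Module.Basis (Fin L.n) R (Fin L.n → R), ∀ i, b i = fun j => (v i j : R) := by
  have hli : LinearIndependent R (fun i => (fun j => (v i j : R))) := by
    refine LinearMap.BilinForm.linearIndependent_of_iIsOrtho (B := blForm L R) ?_ ?_
    · rw [LinearMap.BilinForm.iIsOrtho_def]
      intro i j hij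
      rw [blForm_apply, formR_cast, ho i j hij]; simp
    · intro i
      rw [blForm_apply, formR_cast]
      exact_mod_cast hn i
  by_cases h0 : L.n = 0
  · have : IsEmpty (Fin L.n) := by rw [h0]; infer_instance
    exact ⟨Module.Basis.empty _, fun i => this.elim i⟩
  have : Nonempty (Fin L.n) := ⟨⟨0, Nat.pos_of_ne_zero h0⟩⟩
  refine ⟨basisOfLinearIndependentOfCardEqFinrank hli (by simp), fun i => by simp⟩

open QuadraticMap in
theorem sig_eq (L : EvenLattice) (v : Fin L.n → Fin L.n → ℤ)
    (ho : ∀ i j, i ≠ j → formR L ℤ (v i) (v j) = 0) (hn : ∀ i, formR L ℤ (v i) (v i) ≠ 0) :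
    sigPlus L = {i | 0 < formR L ℤ (v i) (v i)}.ncard ∧
    sigMinus L = {i | formR L ℤ (v i) (v i) < 0}.ncard := by
  have : Invertible (2:ℝ) := invertibleOfNonzero two_ne_zero
  obtain ⟨b, hb⟩ := exists_basis L ℝ v ho hn
  let Q : QuadraticForm ℝ (Fin L.n → ℝ) := (blForm L ℝ).toQuadraticMap
  have hQ : ∀ x, Q x = formR L ℝ x x := fun x => by
    simp only [Q, LinearMap.BilinMap.toQuadraticMap_apply, blForm_apply]
  have hs : ∀ x y, blForm L ℝ x y = blForm L ℝ y x := fun x y => by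
    simp only [blForm_apply]; exact formR_comm L ℝ x y
  have hass : associated (R := ℝ) Q = blForm L ℝ := associated_left_inverse ℝ hs
  have hrep := basisRepr_eq_of_iIsOrtho Q b (by
    rw [hass]
    intro i j hij
    show blForm L ℝ (b i) (b j) = 0
    rw [blForm_apply, hb, hb, formR_cast, ho i j hij]; simp)
  have heq : Equivalent Q (weightedSumSquares ℝ fun i => Q (b i)) := by
    rw [← hrep]; exact ⟨Q.isometryEquivBasisRepr b⟩
  have hw : ∀ i, Q (b i) = ((formR L ℤ (v i) (v i) : ℤ) : ℝ) := fun i => by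
    rw [hQ, hb, formR_cast]
  constructor
  · have h1 := QuadraticForm.sigPos_of_equiv_weightedSumSquares heq
    simp only [hw, Int.cast_pos] at h1
    rw [← h1, ← (sigPos_isGreatest Q).csSup_eq]
    unfold sigPlus PosDef
    congr 1
    ext d
    simp only [Set.mem_ofPred_eq]
    refine exists_congr fun W => and_congr_right fun _ => ?_
    simp [hQ]
  · have h1 := QuadraticForm.sigNeg_of_equiv_weightedSumSquares heq
    simp only [hw, Int.cast_lt_zero] at h1
    rw [← h1, ← (sigNeg_isGreatest Q).csSup_eq]
    unfold sigMinus PosDef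
    congr 1
    ext d
    simp only [Set.mem_ofPred_eq]
    refine exists_congr fun W => and_congr_right fun _ => ?_
    simp [hQ]

/-- `q ↦ exp(π i q)`. -/
noncomputable def ee (q : ℚ) : ℂ := Complex.exp (Real.pi * Complex.I * (q : ℂ))

theorem ee_add (a b : ℚ) : ee (a + b) = ee a * ee b := by
  unfold ee; rw [← Complex.exp_add]; push_cast; ring_nf

theorem ee_sum {ι : Type*} (s : Finset ι) (f : ι → ℚ) : ee (∑ i ∈ s, f i) = ∏ i ∈ s, ee (f i) := by
  unfold ee; rw [← Complex.exp_sum, ← Finset.mul_sum]; push_cast; rfl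

theorem ee_two_mul_eq_one_iff (q : ℚ) : ee (2 * q) = 1 ↔ ∃ m : ℤ, q = m := by
  unfold ee
  rw [Complex.exp_eq_one_iff]
  refine exists_congr fun m => ?_
  have h : (2 * Real.pi * Complex.I : ℂ) ≠ 0 := Complex.two_pi_I_ne_zero
  constructor
  · intro h1
    have h2 : (2 * Real.pi * Complex.I : ℂ) * q = (2 * Real.pi * Complex.I : ℂ) * m := by
      push_cast at h1; linear_combination h1
    exact_mod_cast mul_left_cancel₀ h h2
  · rintro rfl; push_cast; ring

theorem ee_two_int (m : ℤ) : ee (2 * m) = 1 := (ee_two_mul_eq_one_iff _).mpr ⟨m, rfl⟩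

theorem ee_even (m : ℤ) (h : Even m) : ee m = 1 := by
  obtain ⟨k, rfl⟩ := h
  rw [← ee_two_int k]; push_cast; ring_nf

theorem gauss_int (d : ℤ) (N : ℕ) [NeZero N] (hd : d ≠ 0) (hde : Even d) (hN : d.natAbs ∣ N) :
    ∃ r : ℝ, 0 < r ∧ ∑ k : ZMod N, ee (((k.val : ℤ) : ℚ) ^ 2 / d) =
      (r : ℂ) * ee ((SignType.sign d : ℤ) / 4) := by
  have hN0 : 0 < N := Nat.pos_of_ne_zero (NeZero.ne N)
  have hp : 0 < d.natAbs := Int.natAbs_pos.mpr hd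
  have h := gauss_pos d.natAbs N hp (Int.natAbs_even.mpr hde) hN hN0
  refine ⟨N / √(d.natAbs : ℝ), ?_, ?_⟩
  · have : (0:ℝ) < N := by exact_mod_cast hN0
    have : (0:ℝ) < d.natAbs := by exact_mod_cast hp
    positivity
  have hsum : ∑ k : ZMod N, ee (((k.val : ℤ) : ℚ) ^ 2 / d) =
      ∑ k : Fin N, ee (((k.val : ℤ) : ℚ) ^ 2 / d) := by
    cases N with
    | zero => exact absurd rfl (NeZero.ne 0)
    | succ N => rfl
  rw [hsum]
  rcases lt_or_gt_of_ne hd with hneg | hpos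
  · have hda : (d : ℂ) = - (d.natAbs : ℂ) := by
      have : d = - (d.natAbs : ℤ) := by omega
      exact_mod_cast this
    have h' := congrArg (starRingEnd ℂ) h
    rw [map_sum, map_mul, Complex.conj_ofReal, ← Complex.exp_conj] at h'
    simp only [← Complex.exp_conj] at h'
    rw [sign_neg hneg]
    unfold ee
    convert! h' using 2
    · congr 1
      push_cast
      rw [hda]
      simp
      ring
    · congr 1
      have h4 : (starRingEnd ℂ) 4 = 4 := Complex.conj_ofNat 4
      simp [h4]
      ring
  · have hda : (d : ℂ) = (d.natAbs : ℂ) := by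
      have : d = (d.natAbs : ℤ) := by omega
      rw [← Int.cast_natCast, ← this]
    rw [sign_pos hpos]
    unfold ee
    convert! h using 2
    · congr 1
      push_cast
      rw [hda]
      ring
    · congr 1
      simp
      ring

theorem gauss_real (L : EvenLattice) (hL : dualSub L = intSub L) (v : Fin L.n → Fin L.n → ℤ)
    (ho : ∀ i j, i ≠ j → formR L ℤ (v i) (v j) = 0) (hn : ∀ i, formR L ℤ (v i) (v i) ≠ 0)
    (N : ℕ) [NeZero N] (hN : ∀ i, formR L ℤ (v i) (v i) ∣ N) :
    ∃ r : ℝ, 0 < r ∧ ∑ k : Fin L.n → ZMod N,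
      ee (∑ i, (((k i).val : ℤ) : ℚ) ^ 2 / (formR L ℤ (v i) (v i) : ℤ)) = r := by
  classical
  have hN0 : 0 < N := Nat.pos_of_ne_zero (NeZero.ne N)
  obtain ⟨b, hb⟩ := exists_basis L ℚ v ho hn
  obtain ⟨d, hd⟩ : ∃ d : Fin L.n → ℤ, ∀ i, formR L ℤ (v i) (v i) = d i := ⟨_, fun i => rfl⟩
  simp only [hd] at hn hN ⊢
  have hdq : ∀ i, (d i : ℚ) ≠ 0 := fun i => by exact_mod_cast hn i
  have hde : ∀ i, Even (d i) := fun i => by rw [← hd]; exact formR_even L _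
  have hbb : ∀ i j, blForm L ℚ (b i) (b j) = if i = j then (d i : ℚ) else 0 := by
    intro i j
    rw [blForm_apply, hb, hb, formR_cast]
    split_ifs with h
    · subst h; rw [hd]
    · rw [ho i j h]; simp
  -- the vectors
  let X : (Fin L.n → ℤ) → (Fin L.n → ℚ) := fun k => ∑ i, ((k i : ℚ) / d i) • b i
  have hXadd : ∀ k k', X (k + k') = X k + X k' := by
    intro k k'
    simp only [X, ← Finset.sum_add_distrib, ← add_smul]
    refine Finset.sum_congr rfl fun i _ => ?_
    congr 1
    simp only [Pi.add_apply]; push_cast; ring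
  have hbX : ∀ i k, blForm L ℚ (b i) (X k) = k i := by
    intro i k
    simp only [X, map_sum, map_smul, hbb, smul_eq_mul]
    rw [Finset.sum_eq_single i]
    · simp [hdq i]
    · intro j _ hj; simp [hj.symm]
    · simp
  have hXX : ∀ k, formR L ℚ (X k) (X k) = ∑ i, (k i : ℚ) ^ 2 / d i := by
    intro k
    rw [← blForm_apply]
    conv_lhs => enter [1]; simp only [X]
    simp only [map_sum, map_smul, LinearMap.sum_apply, LinearMap.smul_apply, hbX, smul_eq_mul]
    refine Finset.sum_congr rfl fun i _ => by ring
  let F : (Fin L.n → ℤ) → ℂ := fun k => ee (formR L ℚ (X k) (X k))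
  let kap : (Fin L.n → ℤ) → (Fin L.n → ℤ) := fun l i => formR L ℤ (v i) l
  let cst : (Fin L.n → ℤ) → (Fin L.n → ℚ) := fun l j => (l j : ℚ)
  have hXk : ∀ l, X (kap l) = cst l := by
    intro l
    have h1 : cst l = ∑ i, (b.repr (cst l) i) • b i := (b.sum_repr _).symm
    have h2 : ∀ i, b.repr (cst l) i = (kap l i : ℚ) / d i := by
      intro i
      have h3 : blForm L ℚ (b i) (cst l) = b.repr (cst l) i * d i := by
        conv_lhs => rw [h1]
        simp only [map_sum, map_smul, hbb, smul_eq_mul]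
        rw [Finset.sum_eq_single i]
        · simp
        · intro j _ hj; simp [hj.symm]
        · simp
      rw [blForm_apply, hb, formR_cast] at h3
      rw [eq_div_iff (hdq i), ← h3]
    rw [h1]
    simp only [X, h2]
  let chi : (Fin L.n → ℤ) → (Fin L.n → ℤ) → ℂ := fun k l => ee (2 * formR L ℚ (X k) (cst l))
  have hFk : ∀ k l, F (k + kap l) = F k * chi k l := by
    intro k l
    simp only [F, chi]
    have : formR L ℚ (X (k + kap l)) (X (k + kap l)) =
        formR L ℚ (X k) (X k) + 2 * formR L ℚ (X k) (cst l) + ((formR L ℤ l l : ℤ) : ℚ) := by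
      rw [hXadd, hXk, ← formR_cast]
      have hc := formR_comm L ℚ (cst l) (X k)
      simp only [← blForm_apply] at *
      simp only [map_add, LinearMap.add_apply]
      rw [hc]; ring
    rw [this, ee_add, ee_add, ee_even _ (formR_even L l), mul_one]
  have hchi_add : ∀ k l l', chi k (l + l') = chi k l * chi k l' := by
    intro k l l'
    simp only [chi, ← ee_add]
    congr 1
    have : cst (l + l') = cst l + cst l' := by funext j; simp [cst]
    rw [this]
    simp only [← blForm_apply, map_add]; ring
  -- periodicity
  have hFper : ∀ k k' : Fin L.n → ℤ, (∀ i, (N : ℤ) ∣ k i - k' i) → F k = F k' := by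
    intro k k' h
    simp only [F, hXX, ee_sum]
    refine Finset.prod_congr rfl fun i _ => ?_
    obtain ⟨m, hm⟩ := h i
    obtain ⟨e, he⟩ := hN i
    obtain ⟨f, hf⟩ := hde i
    have hk : k i = k' i + d i * e * m := by rw [← he]; linarith
    have hdf : (d i : ℚ) = 2 * f := by rw [hf]; push_cast; ring
    have hfq : (f : ℚ) ≠ 0 := by intro h; apply hdq i; rw [hdf, h, mul_zero]
    have : (k i : ℚ) ^ 2 / d i = (k' i : ℚ) ^ 2 / d i + 2 * ((k' i * e * m + f * e ^ 2 * m ^ 2 : ℤ) : ℚ) := by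
      rw [hk]; push_cast; rw [hdf]; field_simp; ring
    rw [this, ee_add, ee_two_int, mul_one]
  have hchi_per : ∀ k l l', (∀ i, (N : ℤ) ∣ l i - l' i) → chi k l = chi k l' := by
    intro k l l' h
    choose m hm using h
    have hl : l = l' + (N : ℤ) • m := by
      funext i; simp only [Pi.add_apply, Pi.smul_apply, smul_eq_mul, ← hm]; ring
    rw [hl, hchi_add]
    have : chi k ((N : ℤ) • m) = 1 := by
      simp only [chi]
      rw [ee_two_mul_eq_one_iff]
      choose e he using hN
      refine ⟨∑ i, k i * e i * formR L ℤ (v i) m, ?_⟩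
      have h1 : cst ((N : ℤ) • m) = (N : ℚ) • cst m := by funext j; simp [cst]
      rw [h1, ← blForm_apply, map_smul]
      simp only [X, map_sum, map_smul, LinearMap.sum_apply, LinearMap.smul_apply, smul_eq_mul]
      push_cast
      rw [Finset.mul_sum]
      refine Finset.sum_congr rfl fun i _ => ?_
      rw [blForm_apply, hb, formR_cast]
      have : (N : ℚ) = d i * e i := by exact_mod_cast he i
      rw [this]
      have := hdq i
      field_simp
    rw [this, mul_one]
  let vl : (Fin L.n → ZMod N) → (Fin L.n → ℤ) := fun k i => ((k i).val : ℤ)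
  have hvl : ∀ (k : Fin L.n → ZMod N) (c : Fin L.n → ℤ) (i : Fin L.n),
      (N : ℤ) ∣ vl (k + fun i => (c i : ZMod N)) i - (vl k + c) i := by
    intro k c i
    rw [← ZMod.intCast_zmod_eq_zero_iff_dvd]
    simp [vl]
  have hshift : ∀ (G : (Fin L.n → ℤ) → ℂ),
      (∀ k k' : Fin L.n → ℤ, (∀ i, (N : ℤ) ∣ k i - k' i) → G k = G k') →
      ∀ c : Fin L.n → ℤ, ∑ k, G (vl k) = ∑ k, G (vl k + c) := by
    intro G hG c
    rw [← Equiv.sum_comp (Equiv.addRight (fun i => (c i : ZMod N)))]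
    refine Finset.sum_congr rfl fun k _ => ?_
    exact hG _ _ (hvl k c)
  have hT : ∀ k, (∀ l, chi k l = 1) ∧ F k = 1 ∨ ∑ l, chi k (vl l) = 0 := by
    intro k
    by_cases h : ∀ l, chi k l = 1
    · left
      refine ⟨h, ?_⟩
      have hmem : X k ∈ dualSub L := by
        intro y hy
        choose l hl using hy
        have : y = cst l := funext hl
        rw [this]
        exact (ee_two_mul_eq_one_iff _).mp (h l)
      rw [hL] at hmem
      choose u hu using hmem
      have hu' : X k = cst u := funext hu
      simp only [F]
      rw [hu', formR_cast]
      exact ee_even _ (formR_even L u)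
    · right
      push Not at h
      obtain ⟨l0, h0⟩ := h
      have h1 := hshift (chi k) (hchi_per k) l0
      simp only [hchi_add] at h1
      rw [← Finset.sum_mul] at h1
      have : (∑ l, chi k (vl l)) * (chi k l0 - 1) = 0 := by linear_combination -h1
      exact (mul_eq_zero.mp this).resolve_right (sub_ne_zero.mpr h0)
  set S : ℂ := ∑ k, F (vl k) with hS
  have hSS : (Fintype.card (Fin L.n → ZMod N) : ℂ) * S = ∑ k, F (vl k) * ∑ l, chi (vl k) (vl l) := by
    have h1 : ∀ l : Fin L.n → ZMod N, S = ∑ k, F (vl k) * chi (vl k) (vl l) := by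
      intro l
      rw [hS, hshift F hFper (kap (vl l))]
      simp only [hFk]
    calc (Fintype.card (Fin L.n → ZMod N) : ℂ) * S = ∑ l : Fin L.n → ZMod N, S := by simp
      _ = ∑ l : Fin L.n → ZMod N, ∑ k, F (vl k) * chi (vl k) (vl l) :=
          Finset.sum_congr rfl fun l _ => h1 l
      _ = _ := by rw [Finset.sum_comm]; simp only [Finset.mul_sum]
  set C : ℕ := Fintype.card (Fin L.n → ZMod N) with hC
  have hCpos : 0 < C := Fintype.card_pos
  have hterm : ∀ k, ∃ m : ℕ, F (vl k) * ∑ l, chi (vl k) (vl l) = m ∧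
      ((∀ l, chi (vl k) l = 1) → m = C) := by
    intro k
    by_cases hall : ∀ l, chi (vl k) l = 1
    · rcases hT (vl k) with ⟨h1, h2⟩ | h
      · refine ⟨C, ?_, fun _ => rfl⟩
        simp [h2, h1, hC]
      · exfalso
        simp only [hall] at h
        simp at h
        exact hN0.ne' h.1
    · rcases hT (vl k) with ⟨h1, h2⟩ | h
      · exact absurd h1 hall
      · exact ⟨0, by rw [h]; simp, fun h => absurd h hall⟩
  choose m hm hm1 using hterm
  have hm0 : m 0 = C := by
    apply hm1
    intro l
    have : X (vl 0) = 0 := by simp [X, vl]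
    simp only [chi, this, formR_zero_left]
    simp [ee]
  have hmpos : 0 < ∑ k, m k :=
    Finset.sum_pos' (fun _ _ => Nat.zero_le _) ⟨0, Finset.mem_univ _, by rw [hm0]; exact hCpos⟩
  have hCc : (C : ℂ) ≠ 0 := by exact_mod_cast hCpos.ne'
  refine ⟨((∑ k, m k : ℕ) : ℝ) / C, ?_, ?_⟩
  · have h1 : (0:ℝ) < C := by exact_mod_cast hCpos
    have h2 : (0:ℝ) < ((∑ k, m k : ℕ) : ℝ) := by exact_mod_cast hmpos
    positivity
  · have h1 : ∑ k : Fin L.n → ZMod N, ee (∑ i, (((k i).val : ℤ) : ℚ) ^ 2 / (d i : ℤ)) = S := by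
      rw [hS]
      simp only [F, hXX, vl]
    rw [h1]
    simp only [hm] at hSS
    push_cast
    rw [eq_div_iff hCc, mul_comm, hSS]

theorem sig_dvd (L : EvenLattice) (hL : dualSub L = intSub L) (v : Fin L.n → Fin L.n → ℤ)
    (ho : ∀ i j, i ≠ j → formR L ℤ (v i) (v j) = 0) (hn : ∀ i, formR L ℤ (v i) (v i) ≠ 0) :
    (8 : ℤ) ∣ ((sigPlus L : ℤ) - (sigMinus L : ℤ)) := by
  classical
  obtain ⟨h1, h2⟩ := sig_eq L v ho hn
  set N : ℕ := ∏ i, (formR L ℤ (v i) (v i)).natAbs with hNdef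
  have hN0 : N ≠ 0 := Finset.prod_ne_zero_iff.mpr fun i _ => Int.natAbs_ne_zero.mpr (hn i)
  have : NeZero N := ⟨hN0⟩
  have hdvd : ∀ i, (formR L ℤ (v i) (v i)).natAbs ∣ N := fun i =>
    Finset.dvd_prod_of_mem _ (Finset.mem_univ i)
  obtain ⟨r, hr, hS⟩ := gauss_real L hL v ho hn N (fun i => Int.natAbs_dvd_natAbs.mp (by simpa using hdvd i))
  have hg := fun i => gauss_int (formR L ℤ (v i) (v i)) N (hn i) (formR_even L _) (hdvd i)
  choose ρ hρ hg using hg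
  simp only [ee_sum] at hS
  have hprod := Finset.prod_univ_sum (fun _ : Fin L.n => (Finset.univ : Finset (ZMod N)))
    (fun i k => ee (((k.val : ℤ) : ℚ) ^ 2 / (formR L ℤ (v i) (v i) : ℤ)))
  rw [Fintype.piFinset_univ] at hprod
  rw [← hprod] at hS
  simp only [hg] at hS
  rw [Finset.prod_mul_distrib, ← ee_sum, ← Finset.sum_div] at hS
  have hsum : (∑ i, (SignType.sign (formR L ℤ (v i) (v i)) : ℤ)) =
      (sigPlus L : ℤ) - (sigMinus L : ℤ) := by
    rw [h1, h2, Set.ncard_eq_toFinset_card', Set.ncard_eq_toFinset_card']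
    simp only [Set.toFinset_ofPred]
    rw [Finset.card_filter, Finset.card_filter]
    push_cast
    rw [← Finset.sum_sub_distrib]
    refine Finset.sum_congr rfl fun i _ => ?_
    rcases lt_or_gt_of_ne (hn i) with h | h
    · simp [h, h.not_gt, sign_neg h]
    · simp [h, h.not_gt, sign_pos h]
  set s : ℤ := (sigPlus L : ℤ) - (sigMinus L : ℤ) with hs
  have hsumq : (∑ i, ((SignType.sign (formR L ℤ (v i) (v i)) : ℤ) : ℚ)) = s := by
    rw [← hsum]; push_cast; rfl
  rw [hsumq, ← Complex.ofReal_prod] at hS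
  set P : ℝ := ∏ i, ρ i with hP
  have hPpos : 0 < P := Finset.prod_pos fun i _ => hρ i
  have hnorm : ‖ee ((s:ℚ) / 4)‖ = 1 := by
    unfold ee
    have : (Real.pi * Complex.I * (((s:ℚ)/4 : ℚ) : ℂ)) = ((Real.pi * (s / 4) : ℝ) : ℂ) * Complex.I := by
      push_cast; ring
    rw [this, Complex.norm_exp_ofReal_mul_I]
  have hPr : P = r := by
    have := congrArg norm hS
    rw [norm_mul, hnorm, mul_one, Complex.norm_real, Complex.norm_real, Real.norm_of_nonneg hPpos.le,
      Real.norm_of_nonneg hr.le] at this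
    exact this
  have hone : ee ((s:ℚ) / 4) = 1 := by
    rw [hPr] at hS
    have : (r:ℂ) ≠ 0 := by exact_mod_cast hr.ne'
    exact mul_left_cancel₀ this (by rw [hS, mul_one])
  have : ((s:ℚ)/4) = 2 * (s / 8) := by ring
  rw [this, ee_two_mul_eq_one_iff] at hone
  obtain ⟨m, hm⟩ := hone
  refine ⟨m, ?_⟩
  have : (s:ℚ) = 8 * m := by linarith
  exact_mod_cast this

/-- **Signature of even unimodular lattices.** An even unimodular lattice (`L = L^*`) has
`n₊ - n₋ ≡ 0 (mod 8)`; in particular, a positive definite even unimodular lattice has rank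
divisible by `8`. -/
theorem even_unimodular_signature_divisible_by_eight (L : EvenLattice)
    (hL : dualSub L = intSub L) :
    (8 : ℤ) ∣ ((sigPlus L : ℤ) - (sigMinus L : ℤ)) ∧
    ((∀ x : Fin L.n → ℝ, x ≠ 0 → 0 < formR L ℝ x x) → 8 ∣ L.n) := by
  obtain ⟨v, ho, hn⟩ := exists_orth L
  have h8 := sig_dvd L hL v ho hn
  refine ⟨h8, fun hpos => ?_⟩
  obtain ⟨h1, h2⟩ := sig_eq L v ho hn
  have hp : ∀ i, 0 < formR L ℤ (v i) (v i) := by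
    intro i
    have h := hpos (fun j => (v i j : ℝ)) (by
      intro h0
      apply hn i
      have h1 := formR_cast L ℝ (v i) (v i)
      rw [h0, formR_zero_left] at h1
      exact_mod_cast h1.symm)
    rw [formR_cast] at h
    exact_mod_cast h
  have e1 : {i | 0 < formR L ℤ (v i) (v i)} = Set.univ := Set.eq_univ_of_forall hp
  have e2 : {i | formR L ℤ (v i) (v i) < 0} = ∅ := Set.eq_empty_of_forall_notMem fun i h =>
    absurd h (hp i).not_gt
  rw [h1, h2, e1, e2] at h8
  simp only [Set.ncard_univ, Set.ncard_empty, Nat.card_eq_fintype_card, Fintype.card_fin] at h8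
  omega
end
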